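/- Let Γ be a finitely presented residually finite group with finite symmetric generating set S, let Γ ⊳ Γ_1 ⊳ Γ_2 ⊳ … be a nested sequence of finite-index normal subgroups with ∩_{n=1}^∞ Γ_n = {1} and [Γ:Γ_n] → ∞, let 𝒢 = {G_n} be the graph sequence of Cayley graphs of Γ/Γ_n with respect to the image of S, and let K be a field. Then liminf_{n→∞} dim_K (Γ_n^{ab} ⊗_ℤ K)/[Γ:Γ_n] = β_K(𝒢), where Γ_n^{ab} ⊗_ℤ K ≅ H_1(Γ_n, K) is the first group homology of Γ_n with coefficients in K. -/

import Mathlib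

open Filter Function Set
open scoped Classical TensorProduct Pointwise symmDiff

universe u

namespace GraphSeqPaper

/-- The space of `K`-valued antisymmetric functions supported on the (oriented) edges of `G`:
the `K`-vector space spanned by the edges with the convention `(x,y) = -(y,x)`. -/
def edgeSpace (K : Type*) [Field K] {V : Type u} (G : SimpleGraph V) :
    Submodule K (V → V → K) where
  carrier := {f | (∀ x y, ¬ G.Adj x y → f x y = 0) ∧ ∀ x y, f x y = - f y x}
  add_mem' := by
    rintro f g ⟨hf1, hf2⟩ ⟨hg1, hg2⟩
    refine ⟨fun x y h => ?_, fun x y => ?_⟩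
    · simp only [Pi.add_apply, hf1 x y h, hg1 x y h, add_zero]
    · simp only [Pi.add_apply, hf2 x y, hg2 x y]; ring
  zero_mem' := ⟨fun x y _ => rfl, fun x y => by simp⟩
  smul_mem' := by
    rintro c f ⟨hf1, hf2⟩
    refine ⟨fun x y h => ?_, fun x y => ?_⟩
    · simp only [Pi.smul_apply, hf1 x y h, smul_zero]
    · simp only [Pi.smul_apply, hf2 x y, smul_neg]

lemma edgeSpace_mono (K : Type*) [Field K] {V : Type u} {H G : SimpleGraph V}
    (h : H ≤ G) : edgeSpace K H ≤ edgeSpace K G :=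
  fun f hf => ⟨fun x y hxy => hf.1 x y fun ha => hxy (h ha), hf.2⟩

/-- The basis vector of `ε_K` associated to the oriented edge `(x,y)`. -/
noncomputable def edgeVec (K : Type*) [Field K] {V : Type u} (x y : V) : V → V → K :=
  fun a b => if a = x ∧ b = y then (1 : K) else if a = y ∧ b = x then (-1 : K) else 0

/-- The vector of a walk `(x₀, x₁, …, x_l)`, namely `Σ_{i} (x_i, x_{i+1})`. -/
noncomputable def walkVec (K : Type*) [Field K] {V : Type u} {G : SimpleGraph V} :
    ∀ {x y : V}, G.Walk x y → (V → V → K)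
  | _, _, SimpleGraph.Walk.nil => 0
  | _, _, @SimpleGraph.Walk.cons _ _ a b _ _ p => edgeVec K a b + walkVec K p

/-- `C^q_K(G)`: the subspace of `ε_K(G)` spanned by the vectors of cycles of length at most
`q`. -/
noncomputable def cycleSpace (K : Type*) [Field K] {V : Type u} (G : SimpleGraph V) (q : ℕ) :
    Submodule K (V → V → K) :=
  Submodule.span K
    {f | ∃ (x : V) (c : G.Walk x x), c.IsCycle ∧ c.length ≤ q ∧ f = walkVec K c}

/-- A graph sequence: finite simple graphs, of uniformly bounded vertex degrees, whose number
of vertices tends to infinity. -/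
def IsGraphSeq (V : ℕ → Type u) (G : ∀ n, SimpleGraph (V n)) : Prop :=
  (∀ n, Finite (V n)) ∧
    (∃ D : ℕ, ∀ n (x : V n), ((G n).neighborSet x).ncard ≤ D) ∧
      Tendsto (fun n => Nat.card (V n)) atTop atTop

/-- `ℋ ≺ 𝒢`: there is an integer `L > 0` with `d_{G_n}(x,y) ≤ L · d_{H_n}(x,y)` for all `n`
and all vertices `x, y`. -/
def Prec {V : ℕ → Type u} (H G : ∀ n, SimpleGraph (V n)) : Prop :=
  ∃ L : ℕ, 0 < L ∧ ∀ n (x y : V n), (G n).dist x y ≤ L * (H n).dist x y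

/-- `𝒢 ≃ ℋ`: `ℋ ≺ 𝒢` and `𝒢 ≺ ℋ`. -/
def GEquiv {V : ℕ → Type u} (G H : ∀ n, SimpleGraph (V n)) : Prop :=
  Prec H G ∧ Prec G H

/-- The edge number `e(𝒢) = liminf |E(G_n)|/|V(G_n)|`. -/
noncomputable def edgeNum {V : ℕ → Type u} (G : ∀ n, SimpleGraph (V n)) : ℝ :=
  liminf (fun n => ((G n).edgeSet.ncard : ℝ) / (Nat.card (V n) : ℝ)) atTop

/-- The cost `c(𝒢) = inf { e(ℋ) : ℋ ≃ 𝒢 }`. -/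
noncomputable def cost {V : ℕ → Type u} (G : ∀ n, SimpleGraph (V n)) : ℝ :=
  sInf {r : ℝ | ∃ H : ∀ n, SimpleGraph (V n), IsGraphSeq V H ∧ GEquiv G H ∧ r = edgeNum H}

/-- `s^q_K(𝒢) = liminf (|E(G_n)| - dim_K C^q_K(G_n))/|V(G_n)| - 1`. -/
noncomputable def sInv (K : Type*) [Field K] {V : ℕ → Type u}
    (G : ∀ n, SimpleGraph (V n)) (q : ℕ) : ℝ :=
  liminf (fun n =>
    (((G n).edgeSet.ncard : ℝ) - (Module.finrank K (cycleSpace K (G n) q) : ℝ)) /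
      (Nat.card (V n) : ℝ)) atTop - 1

/-- `β_K(𝒢) = inf_q s^q_K(𝒢)`. -/
noncomputable def beta (K : Type*) [Field K] {V : ℕ → Type u}
    (G : ∀ n, SimpleGraph (V n)) : ℝ :=
  ⨅ q : ℕ, sInv K G q

/-- A large girth sequence: for every `k ≥ 1`, all but finitely many `G_n` contain no cycle of
length at most `k`. -/
def LargeGirth {V : ℕ → Type u} (G : ∀ n, SimpleGraph (V n)) : Prop :=
  ∀ k : ℕ, 1 ≤ k → ∃ N : ℕ, ∀ n, N ≤ n →
    ∀ (x : V n) (c : (G n).Walk x x), c.IsCycle → k < c.length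

/-- The set of edges of `G` whose two endpoints lie in different classes of the partition given
by the fibres of `P`. -/
def crossEdges {V : Type u} (G : SimpleGraph V) (P : V → ℕ) : Set (Sym2 V) :=
  {e | e ∈ G.edgeSet ∧ ∃ x ∈ e, ∃ y ∈ e, P x ≠ P y}

/-- Hyperfiniteness of a graph sequence. -/
def Hyperfinite {V : ℕ → Type u} (G : ∀ n, SimpleGraph (V n)) : Prop :=
  ∀ ε : ℝ, 0 < ε → ∃ Kb : ℕ, ∃ P : ∀ n, V n → ℕ,
    (∀ n i, {x : V n | P n x = i}.ncard ≤ Kb) ∧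
      liminf (fun n => ((crossEdges (G n) (P n)).ncard : ℝ) / (Nat.card (V n) : ℝ)) atTop ≤ ε

/-- The Cayley graph of a group with respect to a (symmetric) set `T`:
`x ~ y` iff `x ≠ y` and `y x⁻¹ ∈ T` (or `x y⁻¹ ∈ T`). -/
def cayley (Q : Type u) [Group Q] (T : Set Q) : SimpleGraph Q :=
  SimpleGraph.fromRel (fun x y => y * x⁻¹ ∈ T)

/-- The Cayley graph of the quotient `Γ ⧸ N` with respect to the image of `S`. -/
def cayleyQuot {Γ : Type u} [Group Γ] (N : Subgroup Γ) (hN : N.Normal) (S : Set Γ) :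
    SimpleGraph (Γ ⧸ N) :=
  haveI := hN
  cayley (Γ ⧸ N) ((fun g => (QuotientGroup.mk g : Γ ⧸ N)) '' S)

/-- The minimal number of generators of a group. -/
noncomputable def minGens (Λ : Type u) [Group Λ] : ℕ :=
  sInf {d : ℕ | ∃ T : Set Λ, T.Finite ∧ T.ncard = d ∧ Subgroup.closure T = ⊤}

/-- A group is finitely presented. -/
def FinitelyPresentedGroup (Γ : Type u) [Group Γ] : Prop :=
  ∃ (n : ℕ) (f : FreeGroup (Fin n) →* Γ) (R : Set (FreeGroup (Fin n))),
    Surjective f ∧ R.Finite ∧ f.ker = Subgroup.normalClosure R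

/-- Amenability via the Følner condition. -/
def IsAmenableFolner (Γ : Type u) [Group Γ] : Prop :=
  ∀ F : Set Γ, F.Finite → ∀ ε : ℝ, 0 < ε →
    ∃ A : Set Γ, A.Finite ∧ A.Nonempty ∧
      ∀ s ∈ F, (((s • A) ∆ A).ncard : ℝ) ≤ ε * A.ncard

/-- The set of edges of `G` joining `F` to its complement. -/
def edgeBoundary {V : Type u} (G : SimpleGraph V) (F : Set V) : Set (Sym2 V) :=
  {e | e ∈ G.edgeSet ∧ ∃ x ∈ e, ∃ y ∈ e, x ∈ F ∧ y ∉ F}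

section GraphCochains

variable {K : Type*} [Field K] {V : Type u} {G : SimpleGraph V}

/-- Restriction of a function on ordered pairs of vertices to the edges of `G`, each edge being
given a chosen orientation. -/
noncomputable def edgeRestrict (K : Type*) [Field K] {V : Type u} (G : SimpleGraph V) :
    (V → V → K) →ₗ[K] (G.edgeSet → K) where
  toFun f e := f (Quot.out e.1).1 (Quot.out e.1).2
  map_add' _ _ := rfl
  map_smul' _ _ := rfl

lemma mk_out (e : Sym2 V) : s((Quot.out e).1, (Quot.out e).2) = e := Quot.out_eq e

lemma edgeVec_mem_edgeSpace {x y : V} (h : G.Adj x y) : edgeVec K x y ∈ edgeSpace K G := by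
  refine ⟨fun a b hab => ?_, fun a b => ?_⟩
  · unfold edgeVec
    rw [if_neg, if_neg]
    · rintro ⟨rfl, rfl⟩; exact hab h.symm
    · rintro ⟨rfl, rfl⟩; exact hab h
  · have := h.ne
    unfold edgeVec
    grind

lemma edgeVec_swap {x y : V} (h : x ≠ y) : edgeVec K x y = - edgeVec K y x := by
  funext a b
  simp only [edgeVec, Pi.neg_apply]
  grind

lemma walkVec_mem_edgeSpace {x y : V} (p : G.Walk x y) : walkVec K p ∈ edgeSpace K G := by
  induction p with
  | nil => exact Submodule.zero_mem _
  | cons h p ih => exact Submodule.add_mem _ (edgeVec_mem_edgeSpace h) ih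

lemma cycleSpace_le_edgeSpace (q : ℕ) : cycleSpace K G q ≤ edgeSpace K G := by
  refine Submodule.span_le.2 ?_
  rintro f ⟨x, c, -, -, rfl⟩
  exact walkVec_mem_edgeSpace c

lemma walkVec_append {x y z : V} (p : G.Walk x y) (p' : G.Walk y z) :
    walkVec K (p.append p') = walkVec K p + walkVec K p' := by
  induction p with
  | nil => simp [walkVec]
  | cons h p ih => simp [walkVec, ih, add_assoc]

lemma edgeRestrict_injOn : Set.InjOn (edgeRestrict K G) (edgeSpace K G) := by
  intro f hf g hg hfg
  funext x y
  by_cases h : G.Adj x y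
  · have h1 := congrFun hfg ⟨s(x, y), h⟩
    have h2 := mk_out s(x, y)
    simp only [edgeRestrict, LinearMap.coe_mk, AddHom.coe_mk] at h1
    rcases Sym2.eq_iff.1 h2 with ⟨ha, hb⟩ | ⟨ha, hb⟩
    · rwa [ha, hb] at h1
    · rw [ha, hb] at h1
      rw [hf.2 x y, hg.2 x y, h1]
  · rw [hf.1 x y h, hg.1 x y h]

lemma edgeRestrict_surjOn (u : G.edgeSet → K) : ∃ f ∈ edgeSpace K G, edgeRestrict K G f = u := by
  refine ⟨fun x y => if h : s(x, y) ∈ G.edgeSet then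
    (if Quot.out s(x, y) = (x, y) then u ⟨s(x, y), h⟩ else - u ⟨s(x, y), h⟩) else 0,
    ⟨fun x y h => dif_neg fun h' => h (G.mem_edgeSet.1 h'), fun x y => ?_⟩, ?_⟩
  · have hsw : (s(y, x) : Sym2 V) = s(x, y) := Sym2.eq_swap
    simp only [hsw]
    by_cases h : s(x, y) ∈ G.edgeSet
    · have h2 := mk_out s(x, y)
      have hne := (G.mem_edgeSet.1 h).ne
      rw [dif_pos h, dif_pos h]
      rcases Sym2.eq_iff.1 h2 with ⟨ha, hb⟩ | ⟨ha, hb⟩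
      · have hxy : Quot.out s(x, y) = (x, y) := Prod.ext ha hb
        rw [if_pos hxy, if_neg, neg_neg]
        rw [hxy]
        exact fun h => hne (congrArg Prod.fst h)
      · have hxy : Quot.out s(x, y) = (y, x) := Prod.ext ha hb
        rw [if_pos hxy, if_neg]
        rw [hxy]
        exact fun h => hne (congrArg Prod.snd h)
    · rw [dif_neg h, dif_neg h, neg_zero]
  · funext e
    have h2 := mk_out e.1
    have hadj : s((Quot.out e.1).1, (Quot.out e.1).2) ∈ G.edgeSet := by
      rw [h2]; exact e.2
    simp only [edgeRestrict, LinearMap.coe_mk, AddHom.coe_mk]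
    rw [dif_pos hadj, if_pos (by rw [h2])]
    congr 1
    exact Subtype.ext h2

/-- The pairing of two functions on ordered pairs of vertices, summed over the edges. -/
noncomputable def edgePairing [Fintype G.edgeSet] (φ : V → V → K) : (V → V → K) →ₗ[K] K :=
  (dotProductEquiv K G.edgeSet (edgeRestrict K G φ)).comp (edgeRestrict K G)

lemma edgePairing_edgeVec [Fintype G.edgeSet] {φ : V → V → K} (hφ : φ ∈ edgeSpace K G) {x y : V}
    (h : G.Adj x y) : edgePairing (G := G) φ (edgeVec K x y) = φ x y := by
  simp only [edgePairing, LinearMap.comp_apply, dotProductEquiv_apply_apply, dotProduct]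
  rw [Finset.sum_eq_single ⟨s(x, y), h⟩]
  · have h2 := mk_out s(x, y)
    have hne := h.ne
    simp only [edgeRestrict, LinearMap.coe_mk, AddHom.coe_mk]
    rcases Sym2.eq_iff.1 h2 with ⟨ha, hb⟩ | ⟨ha, hb⟩
    · rw [ha, hb]; simp [edgeVec]
    · rw [ha, hb, hφ.2 x y]; simp [edgeVec, hne.symm]
  · intro e _ he
    have h2 := mk_out e.1
    have hz : edgeVec K x y (Quot.out e.1).1 (Quot.out e.1).2 = 0 := by
      unfold edgeVec
      rw [if_neg, if_neg]
      · rintro ⟨ha, hb⟩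
        rw [ha, hb] at h2
        exact he (Subtype.ext (by rw [← h2]; exact Sym2.eq_swap))
      · rintro ⟨ha, hb⟩
        rw [ha, hb] at h2
        exact he (Subtype.ext h2.symm)
    simp [edgeRestrict, hz]
  · simp

/-- The antisymmetric edge functions that are orthogonal to all cycles of length at most `q`. -/
noncomputable def cocycleSpace (K : Type*) [Field K] {V : Type u} (G : SimpleGraph V)
    [Fintype G.edgeSet] (q : ℕ) : Submodule K (V → V → K) where
  carrier := {φ | φ ∈ edgeSpace K G ∧ ∀ f ∈ cycleSpace K G q, edgePairing (G := G) φ f = 0}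
  add_mem' := by
    rintro φ ψ ⟨h1, h2⟩ ⟨h3, h4⟩
    refine ⟨Submodule.add_mem _ h1 h3, fun f hf => ?_⟩
    have h5 := h2 f hf
    have h6 := h4 f hf
    simp only [edgePairing, map_add, LinearMap.comp_apply, LinearMap.add_apply] at *
    rw [h5, h6, add_zero]
  zero_mem' := ⟨Submodule.zero_mem _, fun f _ => by simp [edgePairing]⟩
  smul_mem' := by
    rintro c φ ⟨h1, h2⟩
    refine ⟨Submodule.smul_mem _ c h1, fun f hf => ?_⟩
    have h5 := h2 f hf
    simp only [edgePairing, map_smul, LinearMap.comp_apply, LinearMap.smul_apply] at *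
    rw [h5, smul_zero]

lemma finrank_map_edgeRestrict {W : Submodule K (V → V → K)} (hW : W ≤ edgeSpace K G) :
    Module.finrank K (W.map (edgeRestrict K G)) = Module.finrank K W := by
  refine (LinearEquiv.ofBijective ((edgeRestrict K G).submoduleMap W) ⟨?_, ?_⟩).finrank_eq.symm
  · intro a b hab
    exact Subtype.ext (edgeRestrict_injOn (hW a.2) (hW b.2) (congrArg Subtype.val hab))
  · exact LinearMap.submoduleMap_surjective _ _

lemma finrank_cycleSpace_add_finrank_cocycleSpace [Fintype G.edgeSet] (q : ℕ) :
    Module.finrank K (cycleSpace K G q) + Module.finrank K (cocycleSpace K G q) =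
      G.edgeSet.ncard := by
  have hc : cocycleSpace K G q ≤ edgeSpace K G := fun φ hφ => hφ.1
  have key := Subspace.finrank_add_finrank_dualAnnihilator_eq
    ((cycleSpace K G q).map (edgeRestrict K G))
  rw [finrank_map_edgeRestrict (cycleSpace_le_edgeSpace q), Module.finrank_fintype_fun_eq_card,
    ← Nat.card_eq_fintype_card, Nat.card_coe_set_eq] at key
  have : ((cocycleSpace K G q).map (edgeRestrict K G)).map
      (dotProductEquiv K G.edgeSet : (G.edgeSet → K) →ₗ[K] Module.Dual K (G.edgeSet → K)) =
      ((cycleSpace K G q).map (edgeRestrict K G)).dualAnnihilator := by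
    ext ℓ
    rw [Submodule.mem_dualAnnihilator]
    constructor
    · rintro ⟨_, ⟨φ, hφ, rfl⟩, rfl⟩ _ ⟨f, hf, rfl⟩
      exact hφ.2 f hf
    · intro hℓ
      obtain ⟨u, rfl⟩ := (dotProductEquiv K G.edgeSet).surjective ℓ
      obtain ⟨φ, hφ, rfl⟩ := edgeRestrict_surjOn u
      exact ⟨_, ⟨φ, ⟨hφ, fun f hf => hℓ _ ⟨f, hf, rfl⟩⟩, rfl⟩, rfl⟩
  rw [← key, ← this, LinearEquiv.finrank_map_eq, finrank_map_edgeRestrict hc]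

lemma walkVec_cons_mem_cycleSpace {x y : V} (h : G.Adj x y) (p : G.Walk y x) (hp : p.IsPath)
    {q : ℕ} (hq : p.length + 1 ≤ q) : walkVec K (p.cons h) ∈ cycleSpace K G q := by
  by_cases he : s(x, y) ∈ p.edges
  · have : p = SimpleGraph.Walk.cons h.symm .nil := by
      cases p with
      | nil => exact absurd rfl h.ne
      | cons h' p' =>
        rename_i z
        rw [SimpleGraph.Walk.cons_isPath_iff] at hp
        rw [SimpleGraph.Walk.edges_cons, List.mem_cons] at he
        rcases he with he | he
        · have hz : z = x := by
            rcases Sym2.eq_iff.1 he with ⟨ha, -⟩ | ⟨ha, -⟩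
            · exact absurd ha h.ne
            · exact ha.symm
          subst hz
          rw [(SimpleGraph.Walk.isPath_iff_nil.1 hp.1).eq_nil]
        · exact absurd (p'.snd_mem_support_of_mem_edges he) hp.2
    subst this
    have : walkVec K (SimpleGraph.Walk.cons h (SimpleGraph.Walk.cons h.symm .nil)) = 0 := by
      simp only [walkVec]
      rw [edgeVec_swap h.ne]
      simp
    rw [this]
    exact Submodule.zero_mem _
  · exact Submodule.subset_span ⟨x, p.cons h,
      (SimpleGraph.Walk.cons_isCycle_iff p h).2 ⟨hp, he⟩, by simpa using hq, rfl⟩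

lemma walkVec_sub_bypass_mem_cycleSpace {x y : V} (p : G.Walk x y) {q : ℕ} (hq : p.length ≤ q) :
    walkVec K p - walkVec K p.bypass ∈ cycleSpace K G q := by
  induction p with
  | nil => simp [SimpleGraph.Walk.bypass]
  | @cons a b c h p ih =>
    rw [SimpleGraph.Walk.length_cons] at hq
    have ih' := ih (by omega)
    simp only [SimpleGraph.Walk.bypass]
    split_ifs with hs
    · have h1 : walkVec K p.bypass = walkVec K (p.bypass.takeUntil a hs) +
          walkVec K (p.bypass.dropUntil a hs) := by
        rw [← walkVec_append, SimpleGraph.Walk.take_spec]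
      have h2 := walkVec_cons_mem_cycleSpace (K := K) h (p.bypass.takeUntil a hs)
        (p.bypass_isPath.takeUntil hs) (q := q) (by
          have := p.bypass.length_takeUntil_le_length hs
          have := p.length_bypass_le_length
          omega)
      have := Submodule.add_mem _ ih' h2
      convert this using 1
      rw [h1]
      simp only [walkVec]
      abel
    · convert ih' using 1
      simp only [walkVec]
      abel

/-- The vector of a closed walk of length at most `q` is a combination of cycles of length at
most `q`. -/
lemma walkVec_mem_cycleSpace {x : V} (p : G.Walk x x) {q : ℕ} (hq : p.length ≤ q) :
    walkVec K p ∈ cycleSpace K G q := by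
  have h := walkVec_sub_bypass_mem_cycleSpace (K := K) p hq
  rwa [(SimpleGraph.Walk.isPath_iff_nil.1 p.bypass_isPath).eq_nil, walkVec, sub_zero] at h

end GraphCochains

section EquivariantPrimitives

variable {K : Type*} [Field K] {Γ : Type u} [Group Γ]

/-- Functions on `Γ` that change by a homomorphism `N → K` under right translation by `N`. -/
def equivariantPrimitives (K : Type*) [Field K] {Γ : Type u} [Group Γ] (N : Subgroup Γ) :
    Submodule K (Γ → K) where
  carrier := {ψ | ∀ g, ∀ n ∈ N, ψ (g * n) = ψ g + ψ n}
  add_mem' := by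
    intro ψ ψ' h h' g n hn
    simp only [Pi.add_apply, h g n hn, h' g n hn]
    abel
  zero_mem' := fun g n _ => by simp
  smul_mem' := by
    intro c ψ h g n hn
    simp only [Pi.smul_apply, h g n hn, smul_add]

variable {N : Subgroup Γ}

lemma equivariantPrimitives.map_one {ψ : Γ → K} (h : ψ ∈ equivariantPrimitives K N) :
    ψ 1 = 0 := by
  simpa using h 1 1 N.one_mem

lemma equivariantPrimitives.eq_zero {ψ : Γ → K} (h : ψ ∈ equivariantPrimitives K N) {S : Set Γ}
    (hS : Subgroup.closure S = ⊤) (hψ : ∀ s ∈ S, ∀ g, ψ (s * g) = ψ g) : ψ = 0 := by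
  have key : ∀ g : Γ, ∀ x, ψ (g * x) = ψ x := by
    intro g
    have hg : g ∈ Subgroup.closure S := hS ▸ Subgroup.mem_top g
    induction hg using Subgroup.closure_induction with
    | mem s hs => exact hψ s hs
    | one => simp
    | mul a b _ _ ha hb => intro x; rw [mul_assoc, ha, hb]
    | inv a _ ha => intro x; rw [← ha, mul_inv_cancel_left]
  funext g
  simpa [equivariantPrimitives.map_one h] using key g 1

lemma equivariantPrimitives.apply_eq {ψ : Γ → K} (h : ψ ∈ equivariantPrimitives K N) (x g : Γ)
    (hxg : (x : Γ ⧸ N) = g) (s : Γ) : ψ (s * x) - ψ x = ψ (s * g) - ψ g := by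
  obtain ⟨n, hn, rfl⟩ : ∃ n ∈ N, x = g * n := ⟨g⁻¹ * x, QuotientGroup.eq.1 hxg.symm, by simp⟩
  rw [← mul_assoc, h _ n hn, h _ n hn]
  abel

lemma finite_equivariantPrimitives [Finite (Γ ⧸ N)] {S : Set Γ} (hSfin : S.Finite)
    (hS : Subgroup.closure S = ⊤) : Module.Finite K (equivariantPrimitives K N) := by
  have : Finite S := hSfin
  let D : (Γ → K) →ₗ[K] ((Γ ⧸ N) × S → K) :=
    { toFun := fun ψ p => ψ (p.2 * p.1.out) - ψ p.1.out
      map_add' := fun ψ ψ' => by funext p; simp only [Pi.add_apply]; abel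
      map_smul' := fun c ψ => by funext p; simp [mul_sub] }
  refine Module.Finite.of_injective (D.comp (equivariantPrimitives K N).subtype) ?_
  rw [← LinearMap.ker_eq_bot, LinearMap.ker_eq_bot']
  rintro ⟨ψ, hψ⟩ h0
  refine Subtype.ext (equivariantPrimitives.eq_zero hψ hS fun s hs g => ?_)
  have h1 : ψ (s * (g : Γ ⧸ N).out) - ψ (g : Γ ⧸ N).out = 0 := congrFun h0 ((g : Γ ⧸ N), ⟨s, hs⟩)
  rw [equivariantPrimitives.apply_eq hψ _ g (QuotientGroup.out_eq' _), sub_eq_zero] at h1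
  exact h1

/-- The homomorphism on the abelianization of `N` given by restricting to `N`. -/
noncomputable def homOfEquivariantPrimitive :
    equivariantPrimitives K N →ₗ[K] (Additive (Abelianization N) →ₗ[ℤ] K) where
  toFun ψ := (MonoidHom.toAdditiveLeft (Abelianization.lift
    ({ toFun := fun n => Multiplicative.ofAdd (ψ.1 n)
       map_one' := by simp [equivariantPrimitives.map_one ψ.2]
       map_mul' := fun a b => by
        rw [Subgroup.coe_mul, ψ.2 _ _ b.2, ofAdd_add] } : N →* Multiplicative K))).toIntLinearMap
  map_add' ψ ψ' := by
    ext a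
    obtain ⟨n, hn⟩ := QuotientGroup.mk_surjective a.toMul
    obtain rfl : a = Additive.ofMul (Abelianization.of n) := by rw [← ofMul_toMul a, ← hn]; rfl
    rfl
  map_smul' c ψ := by
    ext a
    obtain ⟨n, hn⟩ := QuotientGroup.mk_surjective a.toMul
    obtain rfl : a = Additive.ofMul (Abelianization.of n) := by rw [← ofMul_toMul a, ← hn]; rfl
    rfl

/-- An equivariant primitive is determined by its restriction to `N` and by its values on
representatives of the nontrivial cosets, both of which are arbitrary. -/
lemma bijective_homOfEquivariantPrimitive_prod : Bijective
    ((homOfEquivariantPrimitive (K := K) (N := N)).prod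
      ((LinearMap.funLeft K K fun q : {q : Γ ⧸ N // q ≠ ((1 : Γ) : Γ ⧸ N)} => q.1.out).comp
        (equivariantPrimitives K N).subtype)) := by
  constructor
  · rw [← LinearMap.ker_eq_bot, LinearMap.ker_eq_bot']
    rintro ⟨ψ, hψ⟩ h0
    have h1 : ∀ n ∈ N, ψ n = 0 := fun n hn =>
      DFunLike.congr_fun (Prod.ext_iff.1 h0).1 (Additive.ofMul (Abelianization.of ⟨n, hn⟩))
    have h2 : ∀ q : Γ ⧸ N, ψ q.out = 0 := by
      intro q
      by_cases hq : q = ((1 : Γ) : Γ ⧸ N)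
      · refine h1 _ ?_
        have := QuotientGroup.eq.1 (hq.symm.trans (QuotientGroup.out_eq' q).symm)
        simpa using this
      · exact congrFun (Prod.ext_iff.1 h0).2 ⟨q, hq⟩
    refine Subtype.ext (funext fun g => ?_)
    have hg := hψ (g : Γ ⧸ N).out ((g : Γ ⧸ N).out⁻¹ * g)
      (QuotientGroup.eq.1 (QuotientGroup.out_eq' _))
    rw [mul_inv_cancel_left, h2, h1 _ (QuotientGroup.eq.1 (QuotientGroup.out_eq' _))] at hg
    simpa using hg
  · rintro ⟨h, u⟩
    have hmem : ∀ g : Γ, (g : Γ ⧸ N).out⁻¹ * g ∈ N := fun g =>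
      QuotientGroup.eq.1 (QuotientGroup.out_eq' _)
    let η : N → K := fun n => h (Additive.ofMul (Abelianization.of n))
    have hη : ∀ a b, η (a * b) = η a + η b := fun a b => by
      simp only [η, map_mul, ofMul_mul, map_add]
    have hη1 : η 1 = 0 := by simpa using hη 1 1
    have hone : ((1 : Γ) : Γ ⧸ N).out ∈ N := by
      have := QuotientGroup.eq.1 (QuotientGroup.out_eq' ((1 : Γ) : Γ ⧸ N)).symm
      simpa using this
    let v : Γ ⧸ N → K := fun q =>
      if hq : q = ((1 : Γ) : Γ ⧸ N) then η ⟨_, hone⟩ else u ⟨q, hq⟩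
    let ψ : Γ → K := fun g => v g + η ⟨_, hmem g⟩
    have hN : ∀ n : N, ψ n = η n := by
      intro n
      have hn : ((n : Γ) : Γ ⧸ N) = ((1 : Γ) : Γ ⧸ N) := by
        rw [eq_comm, QuotientGroup.eq]; simp
      simp only [ψ, v, dif_pos hn]
      rw [← hη]
      congr 1
      ext
      simp [hn]
    have hmul : ∀ g, ∀ n ∈ N, ψ (g * n) = ψ g + ψ n := by
      intro g n hn
      rw [hN ⟨n, hn⟩]
      have hgn : ((g * n : Γ) : Γ ⧸ N) = (g : Γ ⧸ N) := by
        rw [eq_comm, QuotientGroup.eq]; simpa using hn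
      have hv : v ((g * n : Γ) : Γ ⧸ N) = v g := by rw [hgn]
      simp only [ψ]
      rw [hv, add_assoc, ← hη]
      congr 2
      ext
      simp [hgn, mul_assoc]
    refine ⟨⟨ψ, hmul⟩, Prod.ext ?_ ?_⟩
    · ext a
      obtain ⟨n, hn⟩ := QuotientGroup.mk_surjective a.toMul
      obtain rfl : a = Additive.ofMul (Abelianization.of n) := by rw [← ofMul_toMul a, ← hn]; rfl
      exact hN n
    · funext q
      have : ψ q.1.out = u q := by
        have hq : ((q.1.out : Γ) : Γ ⧸ N) = q.1 := QuotientGroup.out_eq' _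
        have h0 : (⟨_, hmem q.1.out⟩ : N) = 1 := Subtype.ext (by simp [hq])
        simp only [ψ]
        rw [h0, hη1, add_zero, hq]
        exact dif_neg q.2
      exact this

lemma finrank_equivariantPrimitives [Finite (Γ ⧸ N)] {S : Set Γ} (hSfin : S.Finite)
    (hS : Subgroup.closure S = ⊤) :
    Module.finrank K (equivariantPrimitives K N) + 1 =
      Module.finrank K (K ⊗[ℤ] Additive (Abelianization N)) + N.index := by
  have hfin := finite_equivariantPrimitives (K := K) (N := N) hSfin hS
  have : Fintype (Γ ⧸ N) := Fintype.ofFinite _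
  let e := LinearEquiv.ofBijective _ (bijective_homOfEquivariantPrimitive_prod (K := K) (N := N))
  have : Module.Finite K (Additive (Abelianization N) →ₗ[ℤ] K) :=
    have := Module.Finite.equiv e
    Module.Finite.of_surjective (LinearMap.fst K (Additive (Abelianization N) →ₗ[ℤ] K)
      ({q : Γ ⧸ N // q ≠ ((1 : Γ) : Γ ⧸ N)} → K)) LinearMap.fst_surjective
  have hdual : Module.finrank K (Additive (Abelianization N) →ₗ[ℤ] K) =
      Module.finrank K (K ⊗[ℤ] Additive (Abelianization N)) :=
    (LinearMap.liftBaseChangeEquiv K).finrank_eq.trans Subspace.dual_finrank_eq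
  rw [e.finrank_eq, Module.finrank_prod, Module.finrank_fintype_fun_eq_card, hdual, add_assoc,
    Subgroup.index_eq_card, Nat.card_eq_fintype_card, Fintype.card_subtype_compl,
    Fintype.card_subtype_eq]
  have : 0 < Fintype.card (Γ ⧸ N) := Fintype.card_pos_iff.2 ⟨((1 : Γ) : Γ ⧸ N)⟩
  omega

end EquivariantPrimitives

section Presentation

variable {Γ : Type u} [Group Γ]

lemma lift_subtype_val_surjective {S : Set Γ} (hS : Subgroup.closure S = ⊤) :
    Surjective (FreeGroup.lift (Subtype.val : S → Γ)) := by
  rw [← MonoidHom.range_eq_top, FreeGroup.range_lift_eq_closure, Subtype.range_coe, hS]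

/-- A finitely presented group is finitely presented over every finite generating set. -/
lemma FinitelyPresentedGroup.exists_relators (h : FinitelyPresentedGroup Γ) {S : Set Γ}
    (hSfin : S.Finite) (hS : Subgroup.closure S = ⊤) :
    ∃ R : Set (FreeGroup S), R.Finite ∧
      (FreeGroup.lift (Subtype.val : S → Γ)).ker = Subgroup.normalClosure R := by
  obtain ⟨k, f, R, hf, hR, hker⟩ := h
  have : Finite S := hSfin
  have hπ := lift_subtype_val_surjective hS
  set π := FreeGroup.lift (Subtype.val : S → Γ) with hπdef
  let w : FreeGroup (Fin k) →* FreeGroup S :=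
    FreeGroup.lift fun i => surjInv hπ (f (FreeGroup.of i))
  have hw : ∀ x, π (w x) = f x := by
    have : π.comp w = f := FreeGroup.ext_hom _ _ fun i => by simp [w, surjInv_eq hπ]
    exact fun x => DFunLike.congr_fun this x
  let v : S → FreeGroup (Fin k) := fun s => surjInv hf s
  let R' : Set (FreeGroup S) := w '' R ∪ range fun s : S => (FreeGroup.of s)⁻¹ * w (v s)
  refine ⟨R', (hR.image _).union (finite_range _), le_antisymm ?_ ?_⟩
  · let p := QuotientGroup.mk' (Subgroup.normalClosure R')
    have hp : f.ker ≤ (p.comp w).ker := by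
      rw [hker]
      refine Subgroup.normalClosure_le_normal fun r hr => ?_
      exact (QuotientGroup.eq_one_iff _).2
        (Subgroup.subset_normalClosure (Or.inl (mem_image_of_mem w hr)))
    let θ := f.liftOfSurjective hf ⟨p.comp w, hp⟩
    have hθ : ∀ x, θ (f x) = p (w x) := fun x => f.liftOfRightInverse_comp_apply _ _ _ x
    have hθπ : θ.comp π = p := FreeGroup.ext_hom _ _ fun s => by
      have h1 : π (FreeGroup.of s) = f (v s) := by simp [π, v, surjInv_eq hf]
      rw [MonoidHom.comp_apply, h1, hθ]
      have h2 : (FreeGroup.of s : FreeGroup S ⧸ Subgroup.normalClosure R') =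
          (w (v s) : FreeGroup S) :=
        QuotientGroup.eq.2 (Subgroup.subset_normalClosure (Or.inr ⟨s, rfl⟩))
      exact h2.symm
    intro x hx
    rw [← QuotientGroup.eq_one_iff]
    change p x = 1
    rw [← hθπ, MonoidHom.comp_apply, MonoidHom.mem_ker.1 hx, map_one]
  · refine Subgroup.normalClosure_le_normal ?_
    rintro _ (⟨r, hr, rfl⟩ | ⟨s, rfl⟩)
    · have : r ∈ f.ker := hker ▸ Subgroup.subset_normalClosure hr
      exact (hw r).trans this
    · change π _ = 1
      rw [map_mul, map_inv, hw, surjInv_eq hf]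
      simp [π]

end Presentation

section CayleyCochains

variable {K : Type*} [Field K] {Γ : Type u} [Group Γ] {N : Subgroup Γ} [hN : N.Normal] {S : Set Γ}

lemma cayleyQuot_adj (hSsym : ∀ s ∈ S, s⁻¹ ∈ S) {x y : Γ ⧸ N} :
    (cayleyQuot N hN S).Adj x y ↔ x ≠ y ∧ ∃ s ∈ S, (s : Γ ⧸ N) * x = y := by
  unfold cayleyQuot cayley
  rw [SimpleGraph.fromRel_adj]
  refine and_congr_right fun _ => ⟨?_, ?_⟩
  · rintro (⟨s, hs, h⟩ | ⟨s, hs, h⟩)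
    · exact ⟨s, hs, by rw [← eq_mul_inv_iff_mul_eq]; exact h⟩
    · refine ⟨s⁻¹, hSsym s hs, ?_⟩
      have h' : (s : Γ ⧸ N) = x * y⁻¹ := h
      rw [QuotientGroup.mk_inv, h']
      group
  · rintro ⟨s, hs, rfl⟩
    exact Or.inl ⟨s, hs, by simp⟩

lemma ncard_edgeSet_cayleyQuot_le [Finite (Γ ⧸ N)] (hSfin : S.Finite)
    (hSsym : ∀ s ∈ S, s⁻¹ ∈ S) :
    (cayleyQuot N hN S).edgeSet.ncard ≤ S.ncard * N.index := by
  have : Finite S := hSfin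
  let F : S × (Γ ⧸ N) → Sym2 (Γ ⧸ N) := fun p => s(p.2, ((p.1 : Γ) : Γ ⧸ N) * p.2)
  have hsub : (cayleyQuot N hN S).edgeSet ⊆ range F := by
    intro e
    induction e using Sym2.ind with
    | _ x y =>
      intro h
      obtain ⟨-, s, hs, rfl⟩ := (cayleyQuot_adj hSsym).1 ((SimpleGraph.mem_edgeSet _).1 h)
      exact ⟨(⟨s, hs⟩, x), rfl⟩
  calc _ ≤ (range F).ncard := ncard_le_ncard hsub (finite_range F)
    _ ≤ Nat.card (S × (Γ ⧸ N)) := by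
      rw [← image_univ, ← ncard_univ]
      exact ncard_image_le
    _ = _ := by rw [Nat.card_prod, Nat.card_coe_set_eq, Subgroup.index_eq_card]

/-- The coboundary of a function on `Γ`, as a function on ordered pairs of elements of `Γ ⧸ N`. -/
noncomputable def coboundary (K : Type*) [Field K] {Γ : Type u} [Group Γ] (N : Subgroup Γ)
    [N.Normal] (S : Set Γ) : (Γ → K) →ₗ[K] (Γ ⧸ N → Γ ⧸ N → K) where
  toFun ψ x y := if h : ∃ s ∈ S, (s : Γ ⧸ N) * x = y then ψ (h.choose * x.out) - ψ x.out else 0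
  map_add' ψ ψ' := by
    funext x y
    simp only [Pi.add_apply]
    split_ifs
    · abel
    · simp
  map_smul' c ψ := by
    funext x y
    simp only [Pi.smul_apply, RingHom.id_apply]
    split_ifs
    · rw [smul_sub]
    · simp

lemma coboundary_of_not_exists (ψ : Γ → K) {x y : Γ ⧸ N}
    (h : ¬ ∃ s ∈ S, (s : Γ ⧸ N) * x = y) : coboundary K N S ψ x y = 0 := dif_neg h

/-- The ball of radius `m` with respect to `S` meets `N` trivially. -/
def BallMeetsTrivially (N : Subgroup Γ) (S : Set Γ) (m : ℕ) : Prop :=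
  ∀ g ∈ (insert 1 S) ^ m, g ∈ N → g = 1

omit hN in
lemma BallMeetsTrivially.mono {m m' : ℕ} (h : BallMeetsTrivially N S m') (hm : m ≤ m') :
    BallMeetsTrivially N S m :=
  fun g hg => h g (Set.pow_right_monotone (mem_insert _ _) hm hg)

variable {ψ : Γ → K}

lemma coboundary_apply (hψ : ψ ∈ equivariantPrimitives K N) (hB : BallMeetsTrivially N S 2)
    (hSsym : ∀ s ∈ S, s⁻¹ ∈ S) {s : Γ} (hs : s ∈ S) (g : Γ) {y : Γ ⧸ N}
    (hy : (s : Γ ⧸ N) * (g : Γ ⧸ N) = y) :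
    coboundary K N S ψ g y = ψ (s * g) - ψ g := by
  have h : ∃ s ∈ S, (s : Γ ⧸ N) * (g : Γ ⧸ N) = y := ⟨s, hs, hy⟩
  refine (dif_pos h).trans ?_
  have h1 : ((h.choose : Γ) : Γ ⧸ N) = s :=
    mul_right_cancel (h.choose_spec.2.trans hy.symm)
  have h2 : s⁻¹ * h.choose = 1 := by
    refine hB _ ?_ (QuotientGroup.eq.1 h1.symm)
    rw [pow_two]
    exact Set.mul_mem_mul (mem_insert_of_mem _ (hSsym s hs))
      (mem_insert_of_mem _ h.choose_spec.1)
  have h3 : h.choose = s := (inv_mul_eq_one.1 h2).symm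
  rw [h3]
  exact equivariantPrimitives.apply_eq hψ _ _ (QuotientGroup.out_eq' _) _

lemma coboundary_mem_edgeSpace (hψ : ψ ∈ equivariantPrimitives K N)
    (hB : BallMeetsTrivially N S 2) (hSsym : ∀ s ∈ S, s⁻¹ ∈ S) :
    coboundary K N S ψ ∈ edgeSpace K (cayleyQuot N hN S) := by
  refine ⟨fun x y hxy => ?_, fun x y => ?_⟩
  · by_cases h : ∃ s ∈ S, (s : Γ ⧸ N) * x = y
    · obtain ⟨g, rfl⟩ := QuotientGroup.mk_surjective x
      have hxy' : (g : Γ ⧸ N) = y := by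
        by_contra hne
        exact hxy ((cayleyQuot_adj hSsym).2 ⟨hne, h⟩)
      obtain ⟨s, hs, hsy⟩ := h
      rw [coboundary_apply hψ hB hSsym hs g hsy]
      have hsN : s ∈ N := by
        rw [← QuotientGroup.eq_one_iff]
        exact mul_eq_right.1 (hsy.trans hxy'.symm)
      have : s = 1 := hB.mono one_le_two s (by rw [pow_one]; exact mem_insert_of_mem _ hs) hsN
      rw [this, one_mul, sub_self]
    · exact coboundary_of_not_exists ψ h
  · by_cases h : ∃ s ∈ S, (s : Γ ⧸ N) * x = y
    · obtain ⟨s, hs, rfl⟩ := h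
      obtain ⟨g, rfl⟩ := QuotientGroup.mk_surjective x
      rw [coboundary_apply hψ hB hSsym hs g rfl, ← QuotientGroup.mk_mul,
        coboundary_apply hψ hB hSsym (hSsym s hs) (s * g)
          (by rw [QuotientGroup.mk_inv, QuotientGroup.mk_mul, inv_mul_cancel_left]),
        inv_mul_cancel_left, neg_sub]
    · rw [coboundary_of_not_exists ψ h, coboundary_of_not_exists ψ, neg_zero]
      rintro ⟨s, hs, rfl⟩
      exact h ⟨s⁻¹, hSsym s hs, by rw [QuotientGroup.mk_inv, inv_mul_cancel_left]⟩

lemma exists_lift_walk [Fintype (cayleyQuot N hN S).edgeSet] (hψ : ψ ∈ equivariantPrimitives K N)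
    (hB : BallMeetsTrivially N S 2) (hSsym : ∀ s ∈ S, s⁻¹ ∈ S) {x y : Γ ⧸ N}
    (p : (cayleyQuot N hN S).Walk x y) : ∀ g : Γ, (g : Γ ⧸ N) = x →
      ∃ w ∈ (insert 1 S) ^ p.length, ((w * g : Γ) : Γ ⧸ N) = y ∧
        edgePairing (G := cayleyQuot N hN S) (coboundary K N S ψ) (walkVec K p) =
          ψ (w * g) - ψ g := by
  induction p with
  | nil => exact fun g hg => ⟨1, by simp, by simpa using hg, by simp [walkVec]⟩
  | @cons a b c h p ih =>
    rintro g rfl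
    obtain ⟨-, s, hs, hsb⟩ := (cayleyQuot_adj hSsym).1 h
    obtain ⟨w, hw, hwc, hsum⟩ := ih (s * g) hsb
    refine ⟨w * s, ?_, by rwa [mul_assoc], ?_⟩
    · rw [SimpleGraph.Walk.length_cons, pow_succ]
      exact Set.mul_mem_mul hw (mem_insert_of_mem _ hs)
    · rw [walkVec, map_add, hsum,
        edgePairing_edgeVec (coboundary_mem_edgeSpace hψ hB hSsym) h,
        coboundary_apply hψ hB hSsym hs g hsb, mul_assoc]
      abel

lemma coboundary_mem_cocycleSpace [Fintype (cayleyQuot N hN S).edgeSet]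
    (hψ : ψ ∈ equivariantPrimitives K N) (hSsym : ∀ s ∈ S, s⁻¹ ∈ S) {q : ℕ}
    (hB : BallMeetsTrivially N S (q + 2)) :
    coboundary K N S ψ ∈ cocycleSpace K (cayleyQuot N hN S) q := by
  have hB2 := hB.mono (Nat.le_add_left 2 q)
  refine ⟨coboundary_mem_edgeSpace hψ hB2 hSsym, ?_⟩
  suffices h : cycleSpace K (cayleyQuot N hN S) q ≤
      LinearMap.ker (edgePairing (G := cayleyQuot N hN S) (coboundary K N S ψ)) from
    fun f hf => h hf
  refine Submodule.span_le.2 ?_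
  rintro _ ⟨x, c, -, hlen, rfl⟩
  obtain ⟨g, rfl⟩ := QuotientGroup.mk_surjective x
  obtain ⟨w, hw, hwg, hsum⟩ := exists_lift_walk hψ hB2 hSsym c g rfl
  have hwN : w ∈ N := by
    rw [← QuotientGroup.eq_one_iff]
    exact mul_eq_right.1 ((QuotientGroup.mk_mul _ _ _).symm.trans hwg)
  have : w = 1 := hB.mono (by omega) w hw hwN
  rw [SetLike.mem_coe, LinearMap.mem_ker, hsum, this, one_mul, sub_self]

lemma coboundary_injOn (hB : BallMeetsTrivially N S 2) (hSsym : ∀ s ∈ S, s⁻¹ ∈ S)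
    (hS : Subgroup.closure S = ⊤) :
    Injective ((coboundary K N S).domRestrict (equivariantPrimitives K N)) := by
  rw [← LinearMap.ker_eq_bot, LinearMap.ker_eq_bot']
  rintro ⟨ψ, hψ⟩ h0
  refine Subtype.ext (equivariantPrimitives.eq_zero hψ hS fun s hs g => ?_)
  have h1 : coboundary K N S ψ g ((s : Γ ⧸ N) * g) = 0 := congrFun (congrFun h0 _) _
  rwa [coboundary_apply hψ hB hSsym hs g rfl, sub_eq_zero] at h1

/-- The permutation of `Q × K` over left translation by `a` given by the cochain `φ`. -/
def stepPerm {Q : Type*} [Group Q] (φ : Q → Q → K) (a : Q) : Equiv.Perm (Q × K) where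
  toFun p := (a * p.1, p.2 + φ p.1 (a * p.1))
  invFun p := (a⁻¹ * p.1, p.2 - φ (a⁻¹ * p.1) p.1)
  left_inv p := by simp
  right_inv p := by simp

/-- The action of the free group on `(Γ ⧸ N) × K` determined by a cochain. -/
def holonomy (φ : Γ ⧸ N → Γ ⧸ N → K) (S : Set Γ) :
    FreeGroup S →* Equiv.Perm ((Γ ⧸ N) × K) :=
  FreeGroup.lift fun s => stepPerm φ ((s : Γ) : Γ ⧸ N)

variable {φ : Γ ⧸ N → Γ ⧸ N → K}

lemma holonomy_letter (hφ : φ ∈ edgeSpace K (cayleyQuot N hN S)) (a : S × Bool) (x : Γ ⧸ N) :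
    ∀ k, holonomy φ S (FreeGroup.mk [a]) (x, k) =
      (((FreeGroup.lift (Subtype.val : S → Γ) (FreeGroup.mk [a]) : Γ) : Γ ⧸ N) * x,
        k + φ x (((FreeGroup.lift (Subtype.val : S → Γ) (FreeGroup.mk [a]) : Γ) : Γ ⧸ N) * x)) := by
  intro k
  obtain ⟨s, _ | _⟩ := a
  · have : holonomy φ S (FreeGroup.mk [(s, false)]) = (stepPerm φ ((s : Γ) : Γ ⧸ N))⁻¹ := by
      simp [holonomy]
    rw [this]
    change (_, _) = _
    simp only [FreeGroup.lift_mk, List.map_cons, List.map_nil, List.prod_singleton, cond_false,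
      QuotientGroup.mk_inv]
    rw [hφ.2 x, sub_eq_add_neg]
  · have : holonomy φ S (FreeGroup.mk [(s, true)]) = stepPerm φ ((s : Γ) : Γ ⧸ N) := by
      simp [holonomy]
    rw [this]
    simp [stepPerm]

lemma exists_walk_holonomy [Fintype (cayleyQuot N hN S).edgeSet] (hSsym : ∀ s ∈ S, s⁻¹ ∈ S)
    (hφ : φ ∈ edgeSpace K (cayleyQuot N hN S)) (L : List (S × Bool)) : ∀ x : Γ ⧸ N,
    ∃ (y : Γ ⧸ N) (p : (cayleyQuot N hN S).Walk x y), p.length ≤ L.length ∧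
      y = ((FreeGroup.lift (Subtype.val : S → Γ) (FreeGroup.mk L) : Γ) : Γ ⧸ N) * x ∧
      ∀ k, holonomy φ S (FreeGroup.mk L) (x, k) =
        (y, k + edgePairing (G := cayleyQuot N hN S) φ (walkVec K p)) := by
  induction L using List.reverseRecOn with
  | nil =>
    intro x
    refine ⟨x, .nil, le_rfl, ?_, fun k => ?_⟩
    · simp
    · rw [← FreeGroup.one_eq_mk, map_one]
      simp [walkVec]
  | append_singleton L a ih =>
    intro x
    obtain ⟨s, hs, hsa⟩ : ∃ s ∈ S, FreeGroup.lift (Subtype.val : S → Γ) (FreeGroup.mk [a]) = s := by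
      obtain ⟨s, _ | _⟩ := a
      · exact ⟨(s : Γ)⁻¹, hSsym _ s.2, by simp⟩
      · exact ⟨s, s.2, by simp⟩
    have hstep := holonomy_letter hφ a x
    rw [hsa] at hstep
    obtain ⟨y, p, hlen, hy, hp⟩ := ih ((s : Γ ⧸ N) * x)
    have hy' : y = ((FreeGroup.lift (Subtype.val : S → Γ) (FreeGroup.mk (L ++ [a])) : Γ) : Γ ⧸ N)
        * x := by
      rw [hy, ← FreeGroup.mul_mk, map_mul, hsa, QuotientGroup.mk_mul, mul_assoc]
    by_cases hx : x = (s : Γ ⧸ N) * x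
    · refine ⟨y, p.copy hx.symm rfl, by simp; omega, hy', fun k => ?_⟩
      have hz : φ x ((s : Γ ⧸ N) * x) = 0 := hφ.1 _ _ fun h => h.ne hx
      rw [← FreeGroup.mul_mk, map_mul, Equiv.Perm.mul_apply, hstep, hp, hz, add_zero]
      congr 3
      generalize (s : Γ ⧸ N) * x = z at *
      subst hx
      rfl
    · have hadj : (cayleyQuot N hN S).Adj x ((s : Γ ⧸ N) * x) :=
        (cayleyQuot_adj hSsym).2 ⟨hx, s, hs, rfl⟩
      refine ⟨y, .cons hadj p, by simpa using hlen, hy', fun k => ?_⟩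
      rw [← FreeGroup.mul_mk, map_mul, Equiv.Perm.mul_apply, hstep, hp, walkVec, map_add,
        edgePairing_edgeVec hφ hadj, add_assoc]

lemma exists_coboundary_eq [Fintype (cayleyQuot N hN S).edgeSet] (hSsym : ∀ s ∈ S, s⁻¹ ∈ S)
    (hS : Subgroup.closure S = ⊤) (hB : BallMeetsTrivially N S 2) {R : Set (FreeGroup S)}
    (hR : (FreeGroup.lift (Subtype.val : S → Γ)).ker = Subgroup.normalClosure R) {q : ℕ}
    (hq : ∀ r ∈ R, r.toWord.length ≤ q)
    (hφ : φ ∈ cocycleSpace K (cayleyQuot N hN S) q) :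
    ∃ ψ ∈ equivariantPrimitives K N, coboundary K N S ψ = φ := by
  set π := FreeGroup.lift (Subtype.val : S → Γ) with hπdef
  have hπ : Surjective π := lift_subtype_val_surjective hS
  have hker : π.ker ≤ (holonomy φ S).ker := by
    rw [hR]
    refine Subgroup.normalClosure_le_normal fun r hr => ?_
    have hπr : π r = 1 := by
      rw [← MonoidHom.mem_ker, hR]
      exact Subgroup.subset_normalClosure hr
    change holonomy φ S r = 1
    ext1 ⟨x, k⟩
    obtain ⟨y, p, hlen, hy, hp⟩ := exists_walk_holonomy hSsym hφ.1 r.toWord x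
    rw [FreeGroup.mk_toWord, ← hπdef, hπr, QuotientGroup.mk_one, one_mul] at hy
    subst hy
    have hp' := hp k
    rwa [FreeGroup.mk_toWord, hφ.2 _ (walkVec_mem_cycleSpace p (hlen.trans (hq r hr))),
      add_zero] at hp'
  let ρ := π.liftOfSurjective hπ ⟨holonomy φ S, hker⟩
  have hρ : ∀ w, ρ (π w) = holonomy φ S w := fun w => π.liftOfRightInverse_comp_apply _ _ _ w
  have hρ' : ∀ (g : Γ) (x : Γ ⧸ N) (k : K), ρ g (x, k) = ((g : Γ ⧸ N) * x, k + (ρ g (x, 0)).2) := by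
    intro g x k
    obtain ⟨w, rfl⟩ := hπ g
    obtain ⟨y, p, -, hy, hp⟩ := exists_walk_holonomy hSsym hφ.1 w.toWord x
    rw [FreeGroup.mk_toWord] at hy hp
    rw [hρ, hp, hp]
    exact Prod.ext hy (by rw [zero_add])
  let ψ : Γ → K := fun g => (ρ g (1, 0)).2
  have hψ1 : ∀ g, ρ g (1, 0) = ((g : Γ ⧸ N), ψ g) := fun g => by
    rw [hρ', mul_one, zero_add]
  have hψ : ψ ∈ equivariantPrimitives K N := by
    intro g n hn
    have hn1 : (n : Γ ⧸ N) = 1 := (QuotientGroup.eq_one_iff n).2 hn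
    change (ρ (g * n) (1, 0)).2 = _
    rw [map_mul, Equiv.Perm.mul_apply, hψ1 n, hn1, hρ', add_comm]
  refine ⟨ψ, hψ, ?_⟩
  have hmem := coboundary_mem_edgeSpace hψ hB hSsym
  funext x y
  by_cases h : (cayleyQuot N hN S).Adj x y
  · obtain ⟨-, s, hs, rfl⟩ := (cayleyQuot_adj hSsym).1 h
    obtain ⟨g, rfl⟩ := QuotientGroup.mk_surjective x
    rw [coboundary_apply hψ hB hSsym hs g rfl, sub_eq_iff_eq_add, add_comm]
    have hs' : ρ s = stepPerm φ (s : Γ ⧸ N) := by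
      have : π (FreeGroup.of ⟨s, hs⟩) = s := by simp [π]
      rw [← this, hρ]
      simp [holonomy, π]
    change (ρ (s * g) (1, 0)).2 = _
    rw [map_mul, Equiv.Perm.mul_apply, hψ1 g, hs']
    rfl
  · rw [hmem.1 x y h, hφ.1.1 x y h]

lemma finrank_equivariantPrimitives_le [Finite (Γ ⧸ N)] [Fintype (cayleyQuot N hN S).edgeSet]
    (hSsym : ∀ s ∈ S, s⁻¹ ∈ S) (hS : Subgroup.closure S = ⊤) {q : ℕ}
    (hB : BallMeetsTrivially N S (q + 2)) :
    Module.finrank K (equivariantPrimitives K N) ≤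
      Module.finrank K (cocycleSpace K (cayleyQuot N hN S) q) := by
  have hinj := coboundary_injOn (K := K) (hB.mono (Nat.le_add_left 2 q)) hSsym hS
  rw [← LinearMap.finrank_range_of_inj hinj]
  refine Submodule.finrank_mono ?_
  rintro _ ⟨ψ, rfl⟩
  exact coboundary_mem_cocycleSpace ψ.2 hSsym hB

lemma finrank_equivariantPrimitives_eq [Finite (Γ ⧸ N)] [Fintype (cayleyQuot N hN S).edgeSet]
    (hSsym : ∀ s ∈ S, s⁻¹ ∈ S) (hS : Subgroup.closure S = ⊤) {R : Set (FreeGroup S)}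
    (hR : (FreeGroup.lift (Subtype.val : S → Γ)).ker = Subgroup.normalClosure R) {q : ℕ}
    (hq : ∀ r ∈ R, r.toWord.length ≤ q) (hB : BallMeetsTrivially N S (q + 2)) :
    Module.finrank K (equivariantPrimitives K N) =
      Module.finrank K (cocycleSpace K (cayleyQuot N hN S) q) := by
  refine le_antisymm (finrank_equivariantPrimitives_le hSsym hS hB) ?_
  have hB2 := hB.mono (Nat.le_add_left 2 q)
  have hinj := coboundary_injOn (K := K) hB2 hSsym hS
  rw [← LinearMap.finrank_range_of_inj hinj]
  refine Submodule.finrank_mono ?_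
  intro φ hφ
  obtain ⟨ψ, hψ, rfl⟩ := exists_coboundary_eq hSsym hS hB2 hR hq hφ
  exact ⟨⟨ψ, hψ⟩, rfl⟩

end CayleyCochains

section Limits

lemma eventually_ballMeetsTrivially {Γ : Type u} [Group Γ] {S : Set Γ} (hSfin : S.Finite)
    {N : ℕ → Subgroup Γ} (hN : Antitone N) (hinter : ⨅ n, N n = ⊥) (m : ℕ) :
    ∀ᶠ n in atTop, BallMeetsTrivially (N n) S m := by
  have hfin : ((insert 1 S) ^ m : Set Γ).Finite := by
    induction m with
    | zero => simp
    | succ k ih => rw [pow_succ]; exact ih.mul (hSfin.insert 1)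
  refine (eventually_all_finite hfin).2 fun g _ => ?_
  by_cases hg : g = 1
  · exact Eventually.of_forall fun _ _ => hg
  · have : g ∉ ⨅ n, N n := by rwa [hinter, Subgroup.mem_bot]
    rw [Subgroup.mem_iInf, not_forall] at this
    obtain ⟨k, hk⟩ := this
    filter_upwards [eventually_ge_atTop k] with n hn hgn
    exact absurd (hN hn hgn) hk

lemma liminf_add_of_tendsto {u w : ℕ → ℝ} {c : ℝ} (hw : Tendsto w atTop (nhds c))
    (h₁ : IsBoundedUnder (· ≥ ·) atTop u) (h₂ : IsBoundedUnder (· ≤ ·) atTop u) :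
    liminf (w + u) atTop = c + liminf u atTop := by
  apply le_antisymm
  · refine (liminf_add_le hw.isBoundedUnder_ge hw.isBoundedUnder_le h₁ h₂.isCoboundedUnder_ge).trans
      ?_
    rw [hw.limsup_eq]
  · refine le_trans ?_
      (le_liminf_add hw.isBoundedUnder_ge hw.isBoundedUnder_le h₁ h₂.isCoboundedUnder_ge)
    rw [hw.liminf_eq]

lemma iInf_liminf_eq_liminf {d e I : ℕ → ℕ} {c : ℕ → ℕ → ℕ} {C : ℕ} (hpos : ∀ n, 0 < I n)
    (hI : Tendsto I atTop atTop) (he : ∀ n, e n ≤ C * I n)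
    (hle : ∀ q, ∀ᶠ n in atTop, c q n + d n + I n ≤ e n + 1) {q₀ : ℕ}
    (heq : ∀ᶠ n in atTop, c q₀ n + d n + I n = e n + 1) :
    ⨅ q, (liminf (fun n => ((e n : ℝ) - c q n) / I n) atTop - 1) =
      liminf (fun n => (d n : ℝ) / I n) atTop := by
  have hpos' : ∀ n, (0 : ℝ) < I n := fun n => Nat.cast_pos.2 (hpos n)
  set u : ℕ → ℝ := fun n => (d n : ℝ) / I n with hu
  set w : ℕ → ℝ := fun n => 1 - 1 / (I n : ℝ) with hw
  have hwlim : Tendsto w atTop (nhds 1) := by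
    have h0 : Tendsto (fun n => 1 / (I n : ℝ)) atTop (nhds 0) :=
      tendsto_one_div_atTop_nhds_zero_nat.comp hI
    simpa [hw] using h0.const_sub 1
  have hub : IsBoundedUnder (· ≥ ·) atTop u := isBoundedUnder_of ⟨0, fun n => by positivity⟩
  have hua : IsBoundedUnder (· ≤ ·) atTop u := by
    refine isBoundedUnder_of_eventually_le (a := (C : ℝ)) ?_
    filter_upwards [hle 0] with n hn
    rw [hu, div_le_iff₀ (hpos' n)]
    have h1 := hpos n
    have h2 := he n
    exact_mod_cast (by omega : d n ≤ C * I n)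
  have hlim : liminf (w + u) atTop = 1 + liminf u atTop := liminf_add_of_tendsto hwlim hub hua
  have hwu : ∀ n, (w + u) n = ((d n : ℝ) + I n - 1) / I n := fun n => by
    have := (hpos' n).ne'
    simp only [Pi.add_apply, hw, hu]
    field_simp
    ring
  have hge : ∀ q, liminf u atTop ≤ liminf (fun n => ((e n : ℝ) - c q n) / I n) atTop - 1 := by
    intro q
    rw [le_sub_iff_add_le, add_comm, ← hlim]
    refine liminf_le_liminf ?_ ?_ ?_
    · filter_upwards [hle q] with n hn
      rw [hwu]
      have : (c q n : ℝ) + d n + I n ≤ e n + 1 := by exact_mod_cast hn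
      exact div_le_div_of_nonneg_right (by linarith) (hpos' n).le
    · exact isBoundedUnder_ge_add hwlim.isBoundedUnder_ge hub
    · refine (isBoundedUnder_of ⟨(C : ℝ), fun n => ?_⟩ :
        IsBoundedUnder (· ≤ ·) atTop _).isCoboundedUnder_ge
      rw [div_le_iff₀ (hpos' n)]
      have : (e n : ℝ) ≤ C * I n := by exact_mod_cast he n
      have : (0 : ℝ) ≤ c q n := Nat.cast_nonneg _
      linarith
  refine le_antisymm ?_ (le_ciInf hge)
  refine (ciInf_le ⟨liminf u atTop, ?_⟩ q₀).trans ?_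
  · rintro _ ⟨q, rfl⟩
    exact hge q
  · rw [sub_le_iff_le_add, add_comm, ← hlim]
    refine le_of_eq (liminf_congr ?_)
    filter_upwards [heq] with n hn
    rw [hwu]
    have : (c q₀ n : ℝ) + d n + I n = e n + 1 := by exact_mod_cast hn
    congr 1
    linarith

end Limits

theorem homology_gradient_eq_beta (K : Type) [Field K] {Γ : Type u} [Group Γ] (S : Set Γ)
    (hSfin : S.Finite) (hSsym : ∀ s ∈ S, s⁻¹ ∈ S) (hSgen : Subgroup.closure S = ⊤)
    (N : ℕ → Subgroup Γ) (hnorm : ∀ n, (N n).Normal)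
    (hnested : ∀ n, N (n + 1) ≤ N n) (hfi : ∀ n, (N n).FiniteIndex)
    (hinter : ⨅ n, N n = ⊥)
    (hidx : Tendsto (fun n => (N n).index) atTop atTop)
    (hFP : FinitelyPresentedGroup Γ) :
    liminf (fun n =>
        (Module.finrank K (K ⊗[ℤ] Additive (Abelianization ↥(N n))) : ℝ) /
          ((N n).index : ℝ)) atTop =
      beta K (fun n => cayleyQuot (N n) (hnorm n) S) := by
  have : Finite S := hSfin
  have hfinQ : ∀ n, Finite (Γ ⧸ N n) := fun n => inferInstance
  let _ : ∀ n, Fintype (cayleyQuot (N n) (hnorm n) S).edgeSet := fun n => Fintype.ofFinite _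
  obtain ⟨R, hRfin, hR⟩ := hFP.exists_relators hSfin hSgen
  obtain ⟨q₀, hq₀⟩ : ∃ q, ∀ r ∈ R, r.toWord.length ≤ q := by
    obtain ⟨q, hq⟩ := (hRfin.image fun r => r.toWord.length).bddAbove
    exact ⟨q, fun r hr => hq (mem_image_of_mem _ hr)⟩
  have hball := eventually_ballMeetsTrivially hSfin (antitone_nat_of_succ_le hnested) hinter
  have hdim := fun n q => finrank_cycleSpace_add_finrank_cocycleSpace (K := K)
    (G := cayleyQuot (N n) (hnorm n) S) q
  have hW := fun n => finrank_equivariantPrimitives (K := K) (N := N n) hSfin hSgen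
  refine (iInf_liminf_eq_liminf (C := S.ncard) (fun n => Nat.pos_of_ne_zero (hfi n).index_ne_zero)
    hidx (fun n => ncard_edgeSet_cayleyQuot_le hSfin hSsym) (fun q => ?_) (q₀ := q₀) ?_).symm
  · filter_upwards [hball (q + 2)] with n hn
    have := finrank_equivariantPrimitives_le (K := K) hSsym hSgen hn
    have := hdim n q
    have := hW n
    omega
  · filter_upwards [hball (q₀ + 2)] with n hn
    have := finrank_equivariantPrimitives_eq (K := K) hSsym hSgen hR hq₀ hn
    have := hdim n q₀
    have := hW n
    omega

end GraphSeqPaper
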